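/- Fidelity bound against a flat vector: let a, ã and b be probability vectors with a flat and ã ≻ b, and let M be a real number with 0 < M ≤ exp(H(a)). Set N := #{ i : b_i ≥ 1/M }. Then √F(ã, a) ≤ √( (Σ_{i≤N} a↓_i)·(Σ_{j≤N} b↓_j) ) + √( (Σ_{i>N} a↓_i)·(Σ_{j>N} b↓_j) ). -/

import Mathlib

open Finset Filter

noncomputable section

/-- A probability vector: nonnegative entries summing to 1. -/
def IsProbVec {ι : Type*} [Fintype ι] (p : ι → ℝ) : Prop :=
  (∀ i, 0 ≤ p i) ∧ ∑ i, p i = 1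

/-- The sum of the `k` largest entries of `p`: the largest sum over subsets of at
most `k` indices (for nonnegative vectors this equals the sorted partial sum,
with zero padding beyond the dimension). -/
def kMaxSum {ι : Type*} [Fintype ι] (p : ι → ℝ) (k : ℕ) : ℝ :=
  (Finset.univ.powerset.filter (fun s : Finset ι => s.card ≤ k)).sup'
    ⟨∅, by simp⟩ (fun s => ∑ i ∈ s, p i)

/-- `p ≻ q`: for every `k`, the sum of the `k` largest entries of `p` is at least
that of `q` (dimensions may differ, the shorter padded with zeros). -/
def Majorises {ι κ : Type*} [Fintype ι] [Fintype κ] (p : ι → ℝ) (q : κ → ℝ) : Prop :=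
  ∀ k : ℕ, kMaxSum q k ≤ kMaxSum p k

/-- Fidelity `F(p,q) = (Σ_i √(p_i q_i))²`. -/
def fidelity {ι : Type*} [Fintype ι] (p q : ι → ℝ) : ℝ :=
  (∑ i, Real.sqrt (p i * q i)) ^ 2

/-- Infidelity `δ(p,q) = 1 - F(p,q)`. -/
def infid {ι : Type*} [Fintype ι] (p q : ι → ℝ) : ℝ := 1 - fidelity p q

/-- A vector is flat if all of its non-zero entries are equal. -/
def IsFlat {ι : Type*} [Fintype ι] (p : ι → ℝ) : Prop :=
  ∀ i j, p i ≠ 0 → p j ≠ 0 → p i = p j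

/-- Shannon entropy `H(p) = -Σ_i p_i log p_i`. -/
def shannonH {ι : Type*} [Fintype ι] (p : ι → ℝ) : ℝ := -∑ i, p i * Real.log (p i)

/-- The fidelity of two Bernoulli distributions decreases when their parameters move apart. -/
theorem sqrt_mul_add_sqrt_mul_le {u x y t : ℝ} (hu : 0 ≤ u) (hux : u ≤ x) (hxy : x ≤ y)
    (hyt : y ≤ t) (ht : t ≤ 1) :
    √(u * t) + √((1 - u) * (1 - t)) ≤ √(x * y) + √((1 - x) * (1 - y)) := by
  have key : ∀ v w : ℝ, 0 ≤ v → v ≤ w → w ≤ 1 → √(v * w) + √((1 - v) * (1 - w)) =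
      Real.cos (Real.arcsin √w - Real.arcsin √v) := by
    intro v w hv hvw hw
    have hsin : ∀ z : ℝ, 0 ≤ z → z ≤ 1 → Real.sin (Real.arcsin √z) = √z := fun z _ hz1 =>
      Real.sin_arcsin (by linarith [Real.sqrt_nonneg z]) (Real.sqrt_le_one.mpr hz1)
    rw [Real.cos_sub, hsin v hv (by linarith), hsin w (by linarith) hw, Real.cos_arcsin,
      Real.cos_arcsin, Real.sq_sqrt hv, Real.sq_sqrt (hv.trans hvw), Real.sqrt_mul hv,
      Real.sqrt_mul (by linarith)]
    ring
  have mono : ∀ {v w : ℝ}, v ≤ w → Real.arcsin √v ≤ Real.arcsin √w := fun h =>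
    Real.monotone_arcsin (Real.sqrt_le_sqrt h)
  have h1 := mono hux
  have h2 := mono hxy
  have h3 := mono hyt
  rw [key u t hu (by linarith) ht, key x y (by linarith) hxy (by linarith)]
  apply Real.cos_le_cos_of_nonneg_of_le_pi
  · linarith
  · have h4 := Real.arcsin_le_pi_div_two √t
    have h5 := Real.arcsin_nonneg.mpr (Real.sqrt_nonneg u)
    linarith [Real.pi_pos]
  · linarith

theorem sum_le_kMaxSum {ι : Type*} [Fintype ι] (p : ι → ℝ) {k : ℕ} {s : Finset ι}
    (hs : s.card ≤ k) : ∑ i ∈ s, p i ≤ kMaxSum p k :=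
  Finset.le_sup' (fun s : Finset ι => ∑ i ∈ s, p i) (by simpa using hs)

theorem exists_kMaxSum_eq {ι : Type*} [Fintype ι] (p : ι → ℝ) (k : ℕ) :
    ∃ s : Finset ι, s.card ≤ k ∧ kMaxSum p k = ∑ i ∈ s, p i := by
  obtain ⟨s, hs, h⟩ := Finset.exists_mem_eq_sup'
    (s := Finset.univ.powerset.filter (fun s : Finset ι => s.card ≤ k))
    ⟨∅, by simp⟩ (fun s => ∑ i ∈ s, p i)
  exact ⟨s, by simpa using hs, h⟩

/-- The entries of a flat probability vector are at most `exp (-H)`. -/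
theorem IsFlat.le_one_div {ι : Type*} [Fintype ι] {a : ι → ℝ} (haf : IsFlat a)
    (ha : IsProbVec a) {M : ℝ} (hM0 : 0 < M) (hM : M ≤ Real.exp (shannonH a)) (i : ι) :
    a i ≤ 1 / M := by
  rcases (ha.1 i).eq_or_lt' with h0 | hpos
  · rw [h0]
    positivity
  have hH : shannonH a = -Real.log (a i) := by
    have hterm : ∀ j, a j * Real.log (a j) = a j * Real.log (a i) := by
      intro j
      by_cases hj : a j = 0
      · simp [hj]
      · rw [haf j i hj hpos.ne']
    simp only [shannonH, hterm, ← Finset.sum_mul, ha.2, one_mul]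
  rw [hH, Real.exp_neg, Real.exp_log hpos] at hM
  rw [one_div]
  exact (le_inv_comm₀ hM0 hpos).mp hM

theorem sum_sqrt_mul_le {ι : Type*} (p q : ι → ℝ) (hp : ∀ i, 0 ≤ p i) (hq : ∀ i, 0 ≤ q i)
    (s : Finset ι) : ∑ i ∈ s, √(p i * q i) ≤ √((∑ i ∈ s, q i) * ∑ i ∈ s, p i) := by
  rw [mul_comm, Real.sqrt_mul (Finset.sum_nonneg fun i _ => hp i)]
  simpa only [Real.sqrt_mul (hp _)] using Real.sum_sqrt_mul_sqrt_le s hp hq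

open scoped Classical in
/-- fidelity bound against a flat vector: if `a` is flat, `ã ≻ b`,
`0 < M ≤ exp(H(a))` and `N = #{i : b_i ≥ 1/M}`, then
`√F(ã,a) ≤ √((Σ_{i≤N} a↓_i)(Σ_{j≤N} b↓_j)) + √((Σ_{i>N} a↓_i)(Σ_{j>N} b↓_j))`
(partial sorted sums expressed via sums of the `N` largest entries). -/
theorem fidelity_bound_flat
    {d d' : ℕ} (a ta : Fin d → ℝ) (b : Fin d' → ℝ)
    (ha : IsProbVec a) (hta : IsProbVec ta) (hb : IsProbVec b)
    (haf : IsFlat a) (hmaj : Majorises ta b)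
    (M : ℝ) (hM0 : 0 < M) (hM : M ≤ Real.exp (shannonH a)) :
    Real.sqrt (fidelity ta a) ≤
      Real.sqrt (kMaxSum a (Finset.univ.filter fun j => 1 / M ≤ b j).card *
          kMaxSum b (Finset.univ.filter fun j => 1 / M ≤ b j).card)
      + Real.sqrt ((1 - kMaxSum a (Finset.univ.filter fun j => 1 / M ≤ b j).card) *
          (1 - kMaxSum b (Finset.univ.filter fun j => 1 / M ≤ b j).card)) := by
  set N := (Finset.univ.filter fun j => 1 / M ≤ b j).card with hN
  obtain ⟨T, hT, htT⟩ := exists_kMaxSum_eq ta N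
  have hcompl : ∀ p : Fin d → ℝ, IsProbVec p → ∑ i ∈ Tᶜ, p i = 1 - ∑ i ∈ T, p i := by
    intro p hp
    rw [← hp.2, ← Finset.sum_add_sum_compl T p, add_sub_cancel_left]
  have hfid : √(fidelity ta a) ≤ √((∑ i ∈ T, a i) * ∑ i ∈ T, ta i) +
      √((1 - ∑ i ∈ T, a i) * (1 - ∑ i ∈ T, ta i)) := by
    rw [fidelity, Real.sqrt_sq (Finset.sum_nonneg fun i _ => Real.sqrt_nonneg _),
      ← hcompl a ha, ← hcompl ta hta, ← Finset.sum_add_sum_compl T]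
    exact add_le_add (sum_sqrt_mul_le ta a hta.1 ha.1 T) (sum_sqrt_mul_le ta a hta.1 ha.1 Tᶜ)
  refine hfid.trans (sqrt_mul_add_sqrt_mul_le (Finset.sum_nonneg fun i _ => ha.1 i)
    (sum_le_kMaxSum a hT) ?_ ((hmaj N).trans_eq htT) ?_)
  · obtain ⟨S, hS, haS⟩ := exists_kMaxSum_eq a N
    calc kMaxSum a N = ∑ i ∈ S, a i := haS
      _ ≤ S.card • (1 / M) :=
        Finset.sum_le_card_nsmul _ _ _ fun i _ => haf.le_one_div ha hM0 hM i
      _ ≤ N • (1 / M) := nsmul_le_nsmul_left (by positivity) hS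
      _ ≤ ∑ j with 1 / M ≤ b j, b j :=
        Finset.card_nsmul_le_sum _ _ _ fun j hj => (Finset.mem_filter.mp hj).2
      _ ≤ kMaxSum b N := sum_le_kMaxSum b le_rfl
  · rw [← hta.2]
    exact Finset.sum_le_univ_sum_of_nonneg hta.1
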